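/- arXiv:1512.00896 — 4 statements merged into one kernel-verified Lean document; each statement's English description precedes it below -/
import Mathlib

section
/- Let p be a prime with p ≡ 7 (mod 8). Then the sum of the quadratic residues modulo p lying strictly between 0 and p/2 equals the sum of the quadratic nonresidues modulo p lying strictly between 0 and p/2 (both sums taken in the integers). -/
open scoped Classical

/-- Pairing `a` with `2 * m + 1 - a` in a sum over `1, …, 2 * m`. -/
lemma sum_range_two_mul_eq_sum_add_reflect (m : ℕ) (g : ℕ → ℤ) :
    ∑ i ∈ Finset.range (2 * m), g (i + 1) =
      ∑ i ∈ Finset.range m, (g (i + 1) + g (2 * m + 1 - (i + 1))) := by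
  rw [two_mul, Finset.sum_range_add, Finset.sum_add_distrib,
    ← Finset.sum_range_reflect (fun i => g (m + i + 1))]
  congr 1
  refine Finset.sum_congr rfl fun i hi => ?_
  rw [Finset.mem_range] at hi
  congr 1
  omega

/-- Splitting a sum over `1, …, 2 * m` by parity, writing the odd numbers as `2 * m + 1 - 2 * b`. -/
lemma sum_range_two_mul_eq_sum_even_add_odd (m : ℕ) (g : ℕ → ℤ) :
    ∑ i ∈ Finset.range (2 * m), g (i + 1) =
      ∑ i ∈ Finset.range m, (g (2 * (i + 1)) + g (2 * m + 1 - 2 * (i + 1))) := by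
  have parity : ∀ n : ℕ, ∑ i ∈ Finset.range (2 * n), g (i + 1) =
      ∑ i ∈ Finset.range n, g (2 * (i + 1)) + ∑ i ∈ Finset.range n, g (2 * i + 1) := by
    intro n
    induction n with
    | zero => simp
    | succ n ih =>
      rw [mul_add, mul_one, Finset.sum_range_succ, Finset.sum_range_succ, ih,
        Finset.sum_range_succ, Finset.sum_range_succ]
      ring_nf
  rw [parity, Finset.sum_add_distrib, ← Finset.sum_range_reflect (fun i => g (2 * i + 1))]
  congr 1
  refine Finset.sum_congr rfl fun i hi => ?_
  rw [Finset.mem_range] at hi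
  congr 1
  omega

/-- The first moment over the lower half range vanishes for a function that is odd
modulo `2 * m + 1` and invariant under doubling. -/
lemma sum_mul_eq_zero_of_odd_of_two_mul (m : ℕ) (f : ℕ → ℤ)
    (hodd : ∀ a ≤ 2 * m + 1, f (2 * m + 1 - a) = -f a) (htwo : ∀ a, f (2 * a) = f a) :
    ∑ i ∈ Finset.range m, ((i + 1 : ℕ) : ℤ) * f (i + 1) = 0 := by
  have key := (sum_range_two_mul_eq_sum_add_reflect m fun a => (a : ℤ) * f a).symm.trans
    (sum_range_two_mul_eq_sum_even_add_odd m fun a => (a : ℤ) * f a)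
  rw [← sub_eq_zero, ← Finset.sum_sub_distrib] at key
  have hterm : ∀ i ∈ Finset.range m,
      ((i + 1 : ℕ) : ℤ) * f (i + 1) +
          ((2 * m + 1 - (i + 1) : ℕ) : ℤ) * f (2 * m + 1 - (i + 1)) -
        (((2 * (i + 1) : ℕ) : ℤ) * f (2 * (i + 1)) +
          ((2 * m + 1 - 2 * (i + 1) : ℕ) : ℤ) * f (2 * m + 1 - 2 * (i + 1))) =
      -2 * (((i + 1 : ℕ) : ℤ) * f (i + 1)) := by
    intro i hi
    rw [Finset.mem_range] at hi
    rw [hodd _ (by omega), hodd _ (by omega), htwo, Nat.cast_sub (by omega),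
      Nat.cast_sub (by omega)]
    push_cast
    ring
  rw [Finset.sum_congr rfl hterm, ← Finset.mul_sum] at key
  linarith

/-- If `p` is a prime with `p ≡ 7 (mod 8)`, the sum (in `ℤ`) of the quadratic residues
mod `p` lying strictly between `0` and `p/2` equals the sum of the quadratic
nonresidues mod `p` lying strictly between `0` and `p/2`. -/
theorem sum_lower_residues_eq_sum_lower_nonresidues
    (p : ℕ) (hp : p.Prime) (h : p % 8 = 7) :
    ∑ a ∈ (Finset.Icc 1 (p - 1)).filter
        (fun a : ℕ => IsSquare (a : ZMod p) ∧ 2 * a < p), (a : ℤ) =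
    ∑ a ∈ (Finset.Icc 1 (p - 1)).filter
        (fun a : ℕ => ¬ IsSquare (a : ZMod p) ∧ 2 * a < p), (a : ℤ) := by
  have : Fact p.Prime := ⟨hp⟩
  obtain ⟨m, hm⟩ : ∃ m, p = 2 * m + 1 := ⟨p / 2, by omega⟩
  have hp2 : p ≠ 2 := by omega
  have hneg : legendreSym p (-1) = -1 := by
    rw [legendreSym.at_neg_one hp2, ZMod.χ₄_nat_three_mod_four (by omega)]
  have htwo : legendreSym p 2 = 1 := by
    rw [legendreSym.at_two hp2, ZMod.χ₈_nat_eq_if_mod_eight]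
    simp [h, show p % 2 = 1 by omega]
  have hzero := sum_mul_eq_zero_of_odd_of_two_mul m (fun a => legendreSym p a)
    (fun a ha => by
      rw [← hm] at ha ⊢
      have hcast : (((p - a : ℕ) : ℤ) : ZMod p) = ((-1 * (a : ℤ) : ℤ) : ZMod p) := by
        rw [Nat.cast_sub ha]
        simp
      have hcongr : legendreSym p ((p - a : ℕ) : ℤ) = legendreSym p (-1 * (a : ℤ)) := by
        rw [legendreSym, legendreSym, hcast]
      rw [hcongr, legendreSym.mul, hneg, neg_one_mul])
    (fun a => by
      rw [Nat.cast_mul, legendreSym.mul, Nat.cast_ofNat, htwo, one_mul])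
  have hsets : ∀ (P : ℕ → Prop) (_ : DecidablePred fun a => P a ∧ 2 * a < p),
      (Finset.Icc 1 (p - 1)).filter (fun a => P a ∧ 2 * a < p) =
      (Finset.Ico 1 (m + 1)).filter P := by
    intro P _
    ext a
    simp only [Finset.mem_filter, Finset.mem_Icc, Finset.mem_Ico]
    constructor
    · rintro ⟨_, hP, _⟩
      exact ⟨by omega, hP⟩
    · rintro ⟨_, hP⟩
      exact ⟨by omega, hP, by omega⟩
  rw [hsets (fun a => IsSquare (a : ZMod p)) _, hsets (fun a => ¬ IsSquare (a : ZMod p)) _,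
    Finset.sum_filter, Finset.sum_filter, ← sub_eq_zero,
    ← Finset.sum_sub_distrib, Finset.sum_Ico_eq_sum_range]
  refine (Finset.sum_congr (by simp) fun i hi => ?_).trans hzero
  rw [Finset.mem_range] at hi
  rw [add_comm 1 i]
  have hne : (((i + 1 : ℕ) : ℤ) : ZMod p) ≠ 0 := by
    rw [Int.cast_natCast, Ne, ZMod.natCast_eq_zero_iff]
    exact Nat.not_dvd_of_pos_of_lt (by omega) (by omega)
  by_cases hsq : IsSquare ((i + 1 : ℕ) : ZMod p)
  · rw [(legendreSym.eq_one_iff p hne).2 (by rwa [Int.cast_natCast])]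
    simp only [hsq, if_true, not_true, if_false]
    ring
  · rw [(legendreSym.eq_neg_one_iff p).2 (by rwa [Int.cast_natCast])]
    simp only [hsq, if_false, not_false_iff, if_true]
    ring
end

section
/- Let p be a prime with p ≡ 3 (mod 8). Then ∑Q + ∑Q^l = ∑N + ∑N^l, i.e., the sum of all quadratic residues mod p plus the sum of the quadratic residues lying strictly between 0 and p/2 equals the sum of all quadratic nonresidues mod p plus the sum of the quadratic nonresidues lying strictly between 0 and p/2 (all sums taken in the integers). -/
open scoped Classical

open Finset in
/-- Split `{1, …, 2m}` into the lower half and its reflection. -/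
lemma sum_Icc_two_mul_eq_sum_add_reflect {M : Type*} [AddCommMonoid M] (m : ℕ) (g : ℕ → M) :
    ∑ a ∈ Icc 1 (2 * m), g a = ∑ b ∈ Icc 1 m, (g b + g (2 * m + 1 - b)) := by
  rw [sum_add_distrib, ← sum_filter_add_sum_filter_not (Icc 1 (2 * m)) (· ≤ m)]
  congr 1
  · congr 1
    ext a
    simp only [mem_filter, mem_Icc]
    omega
  · refine sum_nbij' (2 * m + 1 - ·) (2 * m + 1 - ·) ?_ ?_ ?_ ?_ ?_ <;>
      simp only [mem_filter, mem_Icc] <;> intro a ha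
    iterate 4 omega
    congr 1
    omega

open Finset in
/-- Split `{1, …, 2m}` into its even members and their reflections. -/
lemma sum_Icc_two_mul_eq_sum_even_add_reflect {M : Type*} [AddCommMonoid M] (m : ℕ)
    (g : ℕ → M) :
    ∑ a ∈ Icc 1 (2 * m), g a = ∑ b ∈ Icc 1 m, (g (2 * b) + g (2 * m + 1 - 2 * b)) := by
  rw [sum_add_distrib, ← sum_filter_add_sum_filter_not (Icc 1 (2 * m)) (· % 2 = 0)]
  congr 1
  · refine sum_nbij' (· / 2) (2 * ·) ?_ ?_ ?_ ?_ ?_ <;>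
      simp only [mem_filter, mem_Icc] <;> intro a ha
    iterate 4 omega
    congr 1
    omega
  · refine sum_nbij' (fun a => (2 * m + 1 - a) / 2) (fun b => 2 * m + 1 - 2 * b)
      ?_ ?_ ?_ ?_ ?_ <;>
      simp only [mem_filter, mem_Icc] <;> intro a ha
    iterate 4 omega
    congr 1
    omega

open Finset in
/-- If `f` is odd under reflection and changes sign under doubling, then its first moment over
`{1, …, 2m}` is the negative of its first moment over the lower half. -/
lemma sum_mul_add_sum_lower_mul_eq_zero (m : ℕ) (f : ℕ → ℤ)
    (hneg : ∀ a ∈ Icc 1 (2 * m), f (2 * m + 1 - a) = -f a)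
    (htwo : ∀ a ∈ Icc 1 m, f (2 * a) = -f a) :
    ∑ a ∈ Icc 1 (2 * m), f a * a + ∑ a ∈ Icc 1 m, f a * a = 0 := by
  have reflect : ∑ a ∈ Icc 1 (2 * m), f a * a =
      2 * ∑ a ∈ Icc 1 m, f a * a - (2 * m + 1) * ∑ a ∈ Icc 1 m, f a := by
    rw [sum_Icc_two_mul_eq_sum_add_reflect, mul_sum, mul_sum, ← sum_sub_distrib]
    refine sum_congr rfl fun a ha => ?_
    rw [mem_Icc] at ha
    rw [hneg a (mem_Icc.2 (by omega)), Nat.cast_sub (by omega)]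
    push_cast
    ring
  have double : ∑ a ∈ Icc 1 (2 * m), f a * a =
      (2 * m + 1) * ∑ a ∈ Icc 1 m, f a - 4 * ∑ a ∈ Icc 1 m, f a * a := by
    rw [sum_Icc_two_mul_eq_sum_even_add_reflect, mul_sum, mul_sum, ← sum_sub_distrib]
    refine sum_congr rfl fun a ha => ?_
    have ha' := mem_Icc.1 ha
    rw [hneg (2 * a) (mem_Icc.2 (by omega)), htwo a ha, Nat.cast_sub (by omega)]
    push_cast
    ring
  linarith

open Finset in
/-- The residue sum minus the nonresidue sum is the sum weighted by the Legendre symbol. -/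
lemma sum_isSquare_sub_sum_not_isSquare (p : ℕ) [Fact p.Prime]
    [hdec : DecidablePred fun a : ℕ => IsSquare (a : ZMod p)] (s : Finset ℕ)
    (hs : ∀ a ∈ s, (a : ZMod p) ≠ 0) :
    ∑ a ∈ s with IsSquare ((a : ℕ) : ZMod p), (a : ℤ) -
      ∑ a ∈ s with ¬ IsSquare ((a : ℕ) : ZMod p), (a : ℤ) =
    ∑ a ∈ s, legendreSym p a * a := by
  rw [sum_filter, sum_filter, ← sum_sub_distrib]
  refine sum_congr rfl fun a ha => ?_
  by_cases hsq : IsSquare (a : ZMod p)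
  · have hl : legendreSym p a = 1 := (legendreSym.eq_one_iff' p (hs a ha)).2 hsq
    simp [hsq, hl]
  · have hl : legendreSym p a = -1 := (legendreSym.eq_neg_one_iff' p).2 hsq
    simp [hsq, hl]

/-- If `p` is a prime with `p ≡ 3 (mod 8)`, then `∑Q + ∑Qˡ = ∑N + ∑Nˡ`, where
`Q`, `N` are the quadratic residues and nonresidues mod `p` among `1, …, p-1`,
and `Qˡ`, `Nˡ` are those less than `p/2`; all sums taken in `ℤ`. -/
theorem sum_residues_add_lower_eq_sum_nonresidues_add_lower
    (p : ℕ) (hp : p.Prime) (h : p % 8 = 3) :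
    (∑ a ∈ (Finset.Icc 1 (p - 1)).filter
        (fun a : ℕ => IsSquare (a : ZMod p)), (a : ℤ)) +
    (∑ a ∈ (Finset.Icc 1 (p - 1)).filter
        (fun a : ℕ => IsSquare (a : ZMod p) ∧ 2 * a < p), (a : ℤ)) =
    (∑ a ∈ (Finset.Icc 1 (p - 1)).filter
        (fun a : ℕ => ¬ IsSquare (a : ZMod p)), (a : ℤ)) +
    (∑ a ∈ (Finset.Icc 1 (p - 1)).filter
        (fun a : ℕ => ¬ IsSquare (a : ZMod p) ∧ 2 * a < p), (a : ℤ)) := by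
  have : Fact p.Prime := ⟨hp⟩
  have hsub := sum_isSquare_sub_sum_not_isSquare p (hdec := fun _ => Classical.propDecidable _)
  obtain ⟨m, rfl⟩ : ∃ m, p = 2 * m + 1 := ⟨p / 2, by omega⟩
  have hne : ∀ a ∈ Finset.Icc 1 (2 * m), (a : ZMod (2 * m + 1)) ≠ 0 := fun a ha h0 => by
    rw [Finset.mem_Icc] at ha
    have := Nat.le_of_dvd ha.1 ((ZMod.natCast_eq_zero_iff _ _).1 h0)
    omega
  have hlower : ∀ (P : ℕ → Prop) [DecidablePred P],
      (Finset.Icc 1 (2 * m)).filter (fun a => P a ∧ 2 * a < 2 * m + 1) =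
        (Finset.Icc 1 m).filter P := fun P _ => by
    ext a
    simp only [Finset.mem_filter, Finset.mem_Icc]
    constructor
    · rintro ⟨_, hP, _⟩
      exact ⟨by omega, hP⟩
    · rintro ⟨_, hP⟩
      exact ⟨by omega, hP, by omega⟩
  have hneg_one : legendreSym (2 * m + 1) (-1) = -1 := by
    rw [legendreSym.at_neg_one (by omega), ZMod.χ₄_nat_three_mod_four (by omega)]
  have htwo : legendreSym (2 * m + 1) 2 = -1 := by
    rw [legendreSym.at_two (by omega), ZMod.χ₈_nat_eq_if_mod_eight]
    simp [h]
  have key := sum_mul_add_sum_lower_mul_eq_zero m (fun a => legendreSym (2 * m + 1) a)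
    (fun a ha => by
      rw [← neg_one_mul, ← hneg_one, ← legendreSym.mul]
      rw [Finset.mem_Icc] at ha
      rw [legendreSym.mod, legendreSym.mod _ (-1 * _)]
      congr 1
      rw [Nat.cast_sub (by omega), sub_eq_add_neg, neg_one_mul, Int.add_emod_left])
    (fun a _ => by rw [Nat.cast_mul, legendreSym.mul, Nat.cast_ofNat, htwo, neg_one_mul])
  have hall := hsub (Finset.Icc 1 (2 * m)) hne
  have hlow := hsub (Finset.Icc 1 m) fun a ha => hne a (Finset.Icc_subset_Icc_right (by omega) ha)
  rw [Nat.add_sub_cancel, hlower, hlower]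
  linarith
end

section
/- Let p be a prime with p ≡ 7 (mod 8), and let n denote the number of quadratic nonresidues mod p that are less than p/2. Then the sum in Z of all quadratic residues mod p (taken among 1,...,p-1) equals n·p. -/
open scoped Classical

/-- If `p ≡ 3 (mod 4)`, then exactly one of `a` and `-a` is a square, for `a ≠ 0`. -/
theorem ZMod.isSquare_neg_iff_not_isSquare {p : ℕ} [Fact p.Prime] (h : p % 4 = 3)
    {a : ZMod p} (ha : a ≠ 0) : IsSquare (-a) ↔ ¬ IsSquare a := by
  have hchar : ringChar (ZMod p) ≠ 2 := by
    rw [ZMod.ringChar_zmod_n]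
    omega
  have hneg : quadraticChar (ZMod p) (-1) = -1 := by
    rw [quadraticChar_neg_one_iff_not_isSquare, ZMod.exists_sq_eq_neg_one_iff]
    omega
  rw [← quadraticChar_one_iff_isSquare (neg_ne_zero.mpr ha),
    ← quadraticChar_neg_one_iff_not_isSquare, neg_eq_neg_one_mul a, map_mul, hneg]
  omega

/-- If `2` is a square mod the odd number `p`, then doubling permutes the squares among
`1, …, p-1`, so their sum is `p` times the number of those above `p / 2`. -/
theorem sum_residues_eq_card_upper_residues_mul {p : ℕ} (hodd : p % 2 = 1)
    (h2 : IsSquare (2 : ZMod p)) :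
    ∑ a ∈ (Finset.Icc 1 (p - 1)).filter (fun a : ℕ => IsSquare (a : ZMod p)), (a : ℤ) =
      ((Finset.Icc 1 (p - 1)).filter
        (fun a : ℕ => IsSquare (a : ZMod p) ∧ p < 2 * a)).card * p := by
  set Q := (Finset.Icc 1 (p - 1)).filter (fun a : ℕ => IsSquare (a : ZMod p)) with hQ
  let f : ℕ → ℕ := fun a => if p < 2 * a then 2 * a - p else 2 * a
  have hcast (a : ℕ) : (f a : ZMod p) = 2 * a := by
    by_cases hlt : p < 2 * a
    · simp [f, hlt, Nat.cast_sub hlt.le]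
    · simp [f, hlt]
  have hmaps : Set.MapsTo f Q Q := by
    intro a ha
    simp only [hQ, Finset.coe_filter, Finset.mem_Icc, Set.mem_ofPred_eq] at ha ⊢
    refine ⟨?_, hcast a ▸ h2.mul ha.2⟩
    dsimp only [f]
    split_ifs <;> omega
  have hinj : Set.InjOn f Q := by
    intro a ha b hb hab
    simp only [hQ, Finset.coe_filter, Finset.mem_Icc, Set.mem_ofPred_eq] at ha hb
    dsimp only [f] at hab
    split_ifs at hab <;> omega
  have hsum : ∑ a ∈ Q, (f a : ℤ) = ∑ a ∈ Q, (a : ℤ) :=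
    Finset.sum_nbij f hmaps hinj (Finset.surjOn_of_injOn_of_card_le f hmaps hinj le_rfl)
      fun _ _ => rfl
  have hf (a : ℕ) : (f a : ℤ) = 2 * a - if p < 2 * a then (p : ℤ) else 0 := by
    dsimp only [f]
    split_ifs <;> omega
  simp only [hf, Finset.sum_sub_distrib, ← Finset.mul_sum, ← Finset.sum_filter,
    Finset.sum_const, nsmul_eq_mul, hQ, Finset.filter_filter] at hsum ⊢
  linarith

/-- If `p ≡ 3 (mod 4)`, then `a ↦ p - a` matches the residues above `p / 2` with the nonresidues
below `p / 2`. -/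
theorem card_upper_residues_eq_card_lower_nonresidues {p : ℕ} (hp : p.Prime)
    (h : p % 4 = 3) :
    ((Finset.Icc 1 (p - 1)).filter
        (fun a : ℕ => IsSquare (a : ZMod p) ∧ p < 2 * a)).card =
      ((Finset.Icc 1 (p - 1)).filter
        (fun a : ℕ => ¬ IsSquare (a : ZMod p) ∧ 2 * a < p)).card := by
  have := Fact.mk hp
  have hsub {a : ℕ} (ha : 1 ≤ a ∧ a ≤ p - 1) :
      IsSquare ((p - a : ℕ) : ZMod p) ↔ ¬ IsSquare (a : ZMod p) := by
    have hne : (a : ZMod p) ≠ 0 := by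
      rw [Ne, ZMod.natCast_eq_zero_iff]
      exact Nat.not_dvd_of_pos_of_lt (by omega) (by omega)
    rw [Nat.cast_sub (by omega), ZMod.natCast_self, zero_sub,
      ZMod.isSquare_neg_iff_not_isSquare h hne]
  refine Finset.card_nbij' (fun a => p - a) (fun a => p - a) ?_ ?_ ?_ ?_ <;> intro a ha <;>
    simp only [Finset.coe_filter, Finset.mem_Icc, Set.mem_ofPred_eq] at ha ⊢
  · exact ⟨by omega, by rw [hsub ha.1]; exact not_not.mpr ha.2.1, by omega⟩
  · exact ⟨by omega, (hsub ha.1).mpr ha.2.1, by omega⟩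
  · omega
  · omega

/-- If `p` is a prime with `p ≡ 7 (mod 8)` and `n` is the number of quadratic
nonresidues mod `p` less than `p/2`, then the sum in `ℤ` of all quadratic
residues mod `p` (among `1, …, p-1`) equals `n * p`. -/
theorem sum_residues_eq_card_lower_nonresidues_mul
    (p : ℕ) (hp : p.Prime) (h : p % 8 = 7) (n : ℕ)
    (hn : n = ((Finset.Icc 1 (p - 1)).filter
        (fun a : ℕ => ¬ IsSquare (a : ZMod p) ∧ 2 * a < p)).card) :
    ∑ a ∈ (Finset.Icc 1 (p - 1)).filter
        (fun a : ℕ => IsSquare (a : ZMod p)), (a : ℤ) = n * p := by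
  have := Fact.mk hp
  have h2 : IsSquare (2 : ZMod p) := (ZMod.exists_sq_eq_two_iff (by omega)).mpr (Or.inr h)
  rw [sum_residues_eq_card_upper_residues_mul (by omega) h2,
    card_upper_residues_eq_card_lower_nonresidues hp (by omega), hn]
end

section
/- Let p be a prime with p ≡ 3 (mod 8), and let n denote the number of quadratic nonresidues mod p that are less than p/2. Then 3·∑Q = n·p + p(p-1)/2, where ∑Q is the sum in Z of all quadratic residues mod p taken among 1,...,p-1. -/
open scoped Classical

theorem ZMod.isSquare_mul_iff_not_isSquare {p : ℕ} [Fact p.Prime] {c a : ZMod p}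
    (hc : ¬ IsSquare c) (ha : a ≠ 0) : IsSquare (c * a) ↔ ¬ IsSquare a := by
  have hc0 : c ≠ 0 := by rintro rfl; exact hc IsSquare.zero
  rw [← quadraticChar_neg_one_iff_not_isSquare,
    ← quadraticChar_one_iff_isSquare (mul_ne_zero hc0 ha), map_mul, quadraticChar_neg_one_iff_not_isSquare.mpr hc]
  constructor <;> intro h <;> linarith

theorem ZMod.natCast_ne_zero_of_mem_Icc {p a : ℕ} (ha : a ∈ Finset.Icc 1 (p - 1)) :
    (a : ZMod p) ≠ 0 := by
  rw [Finset.mem_Icc] at ha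
  rw [Ne, ZMod.natCast_eq_zero_iff]
  exact fun hd => by have := Nat.le_of_dvd (by omega) hd; omega

/-- Negation exchanges the residues above `p / 2` with the nonresidues below `p / 2`. -/
theorem card_residues_upper_half_eq_card_nonresidues_lower_half {p : ℕ} (hp : p.Prime)
    (hneg : ¬ IsSquare (-1 : ZMod p)) (hodd : p % 2 = 1) :
    ((Finset.Icc 1 (p - 1)).filter
        (fun a : ℕ => IsSquare (a : ZMod p) ∧ ¬ 2 * a < p)).card =
      ((Finset.Icc 1 (p - 1)).filter
        (fun a : ℕ => ¬ IsSquare (a : ZMod p) ∧ 2 * a < p)).card := by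
  have : Fact p.Prime := ⟨hp⟩
  have key : ∀ a ∈ Finset.Icc 1 (p - 1),
      (IsSquare ((p - a : ℕ) : ZMod p) ↔ ¬ IsSquare (a : ZMod p)) := by
    intro a ha
    rw [← ZMod.isSquare_mul_iff_not_isSquare hneg (ZMod.natCast_ne_zero_of_mem_Icc ha)]
    rw [Finset.mem_Icc] at ha
    rw [Nat.cast_sub (by omega)]
    simp
  refine Finset.card_nbij' (p - ·) (p - ·) ?_ ?_ ?_ ?_ <;> intro a ha <;>
    simp only [Finset.coe_filter, Set.mem_ofPred_eq] at ha ⊢ <;>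
    obtain ⟨hm, hs, hl⟩ := ha <;> have hk := key a hm <;> rw [Finset.mem_Icc] at hm
  · exact ⟨by rw [Finset.mem_Icc]; omega, by rw [hk]; simpa using hs, by omega⟩
  · exact ⟨by rw [Finset.mem_Icc]; omega, hk.mpr hs, by omega⟩
  · omega
  · omega

/-- Doubling modulo `p` sends the residues onto the nonresidues when `2` is a nonresidue. -/
theorem sum_nonresidues_eq_sum_double_residues {p : ℕ} (hp : p.Prime)
    (htwo : ¬ IsSquare (2 : ZMod p)) (hodd : p % 2 = 1) :
    ∑ b ∈ (Finset.Icc 1 (p - 1)).filter (fun b : ℕ => ¬ IsSquare (b : ZMod p)), (b : ℤ) =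
      ∑ a ∈ (Finset.Icc 1 (p - 1)).filter (fun a : ℕ => IsSquare (a : ZMod p)),
        (2 * (a : ℤ) - if ¬ 2 * a < p then (p : ℤ) else 0) := by
  have : Fact p.Prime := ⟨hp⟩
  have key : ∀ a ∈ Finset.Icc 1 (p - 1), ∀ b : ℕ, b = 2 * a ∨ b + p = 2 * a →
      (IsSquare (b : ZMod p) ↔ ¬ IsSquare (a : ZMod p)) := by
    intro a ha b hb
    rw [← ZMod.isSquare_mul_iff_not_isSquare htwo (ZMod.natCast_ne_zero_of_mem_Icc ha)]
    have hcast : (b : ZMod p) = 2 * a := by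
      rcases hb with hb | hb <;> simpa using congrArg (Nat.cast : ℕ → ZMod p) hb
    rw [hcast]
  symm
  refine Finset.sum_nbij' (fun a => if 2 * a < p then 2 * a else 2 * a - p)
    (fun b => if b % 2 = 0 then b / 2 else (b + p) / 2) ?_ ?_ ?_ ?_ ?_ <;> intro a ha <;>
    simp only [Finset.mem_filter] at ha ⊢ <;>
    obtain ⟨hm, hs⟩ := ha <;> have hm' := hm <;> rw [Finset.mem_Icc] at hm'
  · refine ⟨by rw [Finset.mem_Icc]; split_ifs <;> omega, ?_⟩
    rw [key a hm _ (by split_ifs <;> omega)]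
    simpa using hs
  · have hmem : (if a % 2 = 0 then a / 2 else (a + p) / 2) ∈ Finset.Icc 1 (p - 1) := by
      rw [Finset.mem_Icc]; split_ifs <;> omega
    refine ⟨hmem, ?_⟩
    have hk := key _ hmem a (by split_ifs <;> omega)
    exact not_not.mp (mt hk.mpr hs)
  · split_ifs <;> omega
  · split_ifs <;> omega
  · split_ifs <;> omega

/-- If `p` is a prime with `p ≡ 3 (mod 8)` and `n` is the number of quadratic
nonresidues mod `p` less than `p/2`, then `3·∑Q = n·p + p(p-1)/2`, where `∑Q`
is the sum in `ℤ` of all quadratic residues mod `p` among `1, …, p-1`. -/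
theorem three_mul_sum_residues_eq
    (p : ℕ) (hp : p.Prime) (h : p % 8 = 3) (n : ℕ)
    (hn : n = ((Finset.Icc 1 (p - 1)).filter
        (fun a : ℕ => ¬ IsSquare (a : ZMod p) ∧ 2 * a < p)).card) :
    3 * ∑ a ∈ (Finset.Icc 1 (p - 1)).filter
        (fun a : ℕ => IsSquare (a : ZMod p)), (a : ℤ) =
      n * p + p * (p - 1) / 2 := by
  have hneg : ¬ IsSquare (-1 : ZMod p) := by
    have : Fact p.Prime := ⟨hp⟩
    rw [ZMod.exists_sq_eq_neg_one_iff]; omega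
  have htwo : ¬ IsSquare (2 : ZMod p) := by
    have : Fact p.Prime := ⟨hp⟩
    rw [ZMod.exists_sq_eq_two_iff (by omega)]; omega
  have hdouble := sum_nonresidues_eq_sum_double_residues hp htwo (by omega)
  rw [Finset.sum_sub_distrib, ← Finset.mul_sum, ← Finset.sum_filter, Finset.filter_filter,
    Finset.sum_const, card_residues_upper_half_eq_card_nonresidues_lower_half hp hneg (by omega),
    ← hn, nsmul_eq_mul] at hdouble
  have hsplit := Finset.sum_filter_add_sum_filter_not (Finset.Icc 1 (p - 1))
    (fun a : ℕ => IsSquare (a : ZMod p)) (fun a => (a : ℤ))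
  have htotal : ∑ a ∈ Finset.Icc 1 (p - 1), (a : ℤ) = p * (p - 1) / 2 := by
    have hrange : Finset.range p = insert 0 (Finset.Icc 1 (p - 1)) := by
      ext a; simp only [Finset.mem_range, Finset.mem_insert, Finset.mem_Icc]
      have := hp.pos
      omega
    have hsum := Finset.sum_range_id_mul_two p
    rw [hrange, Finset.sum_insert (by simp)] at hsum
    zify [hp.one_le] at hsum
    omega
  linarith
end
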